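/- arXiv:2312.13183 — 3 statements merged into one kernel-verified Lean document; each statement's English description precedes it below -/
import Mathlib

section
/- There is no sequence (q_n)_{n∈ℕ} of continuously differentiable real-valued functions on [0,1] such that simultaneously: (a) (q_n) is an orthogonal basis of the weighted space, i.e. ⟨⟨q_m, q_n⟩⟩ = 0 for all m ≠ n, ⟨⟨q_n, q_n⟩⟩ > 0 for all n, and the linear span of {q_n : n ∈ ℕ} is dense in L²((0,1), w(x)dx); (b) q_n(1) = 0 for all n ∈ ℕ; and (c) the differentiation matrix D_{m,n} = ⟨⟨q_m', q_n⟩⟩ is skew-symmetric, i.e. D_{m,n} = -D_{n,m} for all m, n ∈ ℕ. -/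
open MeasureTheory Set

lemma ContDiffOn.exists_continuousOn_eqOn_deriv {f : ℝ → ℝ} {a b : ℝ} (hab : a < b)
    (hf : ContDiffOn ℝ 1 f (Icc a b)) :
    ∃ f' : ℝ → ℝ, ContinuousOn f' (Icc a b) ∧ EqOn (deriv f) f' (Ioo a b) :=
  ⟨derivWithin f (Icc a b), hf.continuousOn_derivWithin (uniqueDiffOn_Icc hab) le_rfl,
    fun _ hx => (derivWithin_of_mem_nhds (Icc_mem_nhds hx.1 hx.2)).symm⟩

lemma ContDiffOn.hasDerivAt_of_mem_Ioo {f : ℝ → ℝ} {a b x : ℝ}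
    (hf : ContDiffOn ℝ 1 f (Icc a b)) (hx : x ∈ Ioo a b) : HasDerivAt f (deriv f x) x :=
  ((hf.differentiableOn one_ne_zero).differentiableAt (Icc_mem_nhds hx.1 hx.2)).hasDerivAt

lemma ContDiffOn.integrableOn_deriv_mul {f g : ℝ → ℝ} {a b : ℝ} (hab : a < b)
    (hf : ContDiffOn ℝ 1 f (Icc a b)) (hg : ContinuousOn g (Icc a b)) :
    IntegrableOn (fun x => deriv f x * g x) (Ioo a b) := by
  obtain ⟨f', hc, he⟩ := hf.exists_continuousOn_eqOn_deriv hab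
  refine (((hc.mul hg).integrableOn_Icc).mono_set Ioo_subset_Icc_self).congr_fun
    (fun x hx => ?_) measurableSet_Ioo
  simp [he hx]

/-- The integral of `(w f g)'` over `(a, b)`, with each product-rule term separated. -/
lemma setIntegral_deriv_mul_mul {w f g : ℝ → ℝ} {a b : ℝ} (hab : a < b)
    (hw : ContDiffOn ℝ 1 w (Icc a b)) (hf : ContDiffOn ℝ 1 f (Icc a b))
    (hg : ContDiffOn ℝ 1 g (Icc a b)) :
    (∫ x in Ioo a b, deriv w x * f x * g x) + (∫ x in Ioo a b, w x * deriv f x * g x)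
      + (∫ x in Ioo a b, w x * deriv g x * f x) = w b * f b * g b - w a * f a * g a := by
  have h1 : IntegrableOn (fun x => deriv w x * f x * g x) (Ioo a b) := by
    simpa only [Pi.mul_apply, mul_assoc] using
      hw.integrableOn_deriv_mul hab (hf.continuousOn.mul hg.continuousOn)
  have h2 : IntegrableOn (fun x => w x * deriv f x * g x) (Ioo a b) := by
    simpa only [Pi.mul_apply, mul_assoc, mul_left_comm] using
      hf.integrableOn_deriv_mul hab (hw.continuousOn.mul hg.continuousOn)
  have h3 : IntegrableOn (fun x => w x * deriv g x * f x) (Ioo a b) := by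
    simpa only [Pi.mul_apply, mul_assoc, mul_left_comm] using
      hg.integrableOn_deriv_mul hab (hw.continuousOn.mul hf.continuousOn)
  have h12 : IntegrableOn (fun x => deriv w x * f x * g x + w x * deriv f x * g x) (Ioo a b) :=
    h1.add h2
  rw [← integral_add h1 h2, ← integral_add h12 h3, ← integral_Ioc_eq_integral_Ioo,
    ← intervalIntegral.integral_of_le hab.le]
  refine intervalIntegral.integral_eq_sub_of_hasDerivAt_of_le (f := fun x => w x * f x * g x)
    hab.le ((hw.continuousOn.mul hf.continuousOn).mul hg.continuousOn) (fun x hx => ?_) ?_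
  · refine (((hw.hasDerivAt_of_mem_Ioo hx).mul (hf.hasDerivAt_of_mem_Ioo hx)).mul
      (hg.hasDerivAt_of_mem_Ioo hx)).congr_deriv ?_
    simp only [Pi.mul_apply]
    ring
  · rw [intervalIntegrable_iff_integrableOn_Ioo_of_le hab.le]
    exact h12.add h3

/-- An `L²` function orthogonal to a family with dense span vanishes almost everywhere. -/
lemma MeasureTheory.MemLp.ae_eq_zero_of_dense_span {α ι : Type*} [MeasurableSpace α]
    {μ : Measure α} {q : ι → α → ℝ}
    (hq : Dense (Submodule.span ℝ {f : Lp ℝ 2 μ | ∃ n, (f : α → ℝ) =ᵐ[μ] q n} : Set (Lp ℝ 2 μ)))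
    {g : α → ℝ} (hg : MemLp g 2 μ) (horth : ∀ n, ∫ x, g x * q n x ∂μ = 0) : g =ᵐ[μ] 0 := by
  have hzero : hg.toLp g = 0 := by
    refine hq.eq_zero_of_mem_orthogonal (𝕜 := ℝ) ?_
    rw [Submodule.mem_orthogonal']
    intro u hu
    induction hu using Submodule.span_induction with
    | mem f hf =>
      obtain ⟨n, hn⟩ := hf
      rw [L2.inner_def, ← horth n]
      refine integral_congr_ae ?_
      filter_upwards [hn, hg.coeFn_toLp] with x h1 h2
      simp [h1, h2, mul_comm]
    | zero => simp
    | add f g _ _ hf hg => rw [inner_add_right, hf, hg, add_zero]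
    | smul c f _ hf => rw [inner_smul_right, hf, mul_zero]
  exact (hg.toLp_eq_toLp_iff MemLp.zero).1 (by rw [hzero]; rfl)

/-- A function that is square-integrable against the weight `w` and `w`-orthogonal to a family
with dense span vanishes almost everywhere where `w` is positive. -/
lemma ae_eq_zero_of_weighted_orthogonal {ι : Type*} {s : Set ℝ} (hs : MeasurableSet s)
    {w : ℝ → ℝ} (hw : AEMeasurable w (volume.restrict s)) (hwpos : ∀ x ∈ s, 0 < w x)
    {q : ι → ℝ → ℝ}
    (hq : Dense (Submodule.span ℝ
        {f : Lp ℝ 2 ((volume.restrict s).withDensity (fun x => ENNReal.ofReal (w x))) |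
          ∃ n, (f : ℝ → ℝ)
            =ᵐ[(volume.restrict s).withDensity (fun x => ENNReal.ofReal (w x))] q n} :
        Set (Lp ℝ 2 ((volume.restrict s).withDensity (fun x => ENNReal.ofReal (w x))))))
    {g : ℝ → ℝ} (hgm : AEMeasurable g (volume.restrict s))
    (hg : IntegrableOn (fun x => w x * g x ^ 2) s)
    (horth : ∀ n, ∫ x in s, w x * (g x * q n x) = 0) :
    ∀ᵐ x ∂volume.restrict s, g x = 0 := by
  have hae : ∀ᵐ x ∂volume.restrict s, 0 < w x := by
    filter_upwards [ae_restrict_mem hs] with x hx using hwpos x hx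
  have hgμ := hgm.aestronglyMeasurable.mono_ac
    (withDensity_absolutelyContinuous _ fun x => ENNReal.ofReal (w x))
  have hL : MemLp g 2 ((volume.restrict s).withDensity fun x => ENNReal.ofReal (w x)) := by
    rw [memLp_two_iff_integrable_sq hgμ,
      integrable_withDensity_iff_integrable_smul₀' hw.ennreal_ofReal (by simp)]
    refine hg.congr ?_
    filter_upwards [hae] with x hx
    simp [ENNReal.toReal_ofReal hx.le]
  have h0 := hL.ae_eq_zero_of_dense_span hq fun n => by
    rw [integral_withDensity_eq_integral_toReal_smul₀ hw.ennreal_ofReal (by simp), ← horth n]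
    refine integral_congr_ae ?_
    filter_upwards [hae] with x hx
    simp [ENNReal.toReal_ofReal hx.le]
  rw [Filter.EventuallyEq, ae_withDensity_iff' hw.ennreal_ofReal] at h0
  filter_upwards [h0, hae] with x h1 h2
  exact h1 (by simpa using h2)

/-- There is no sequence `q n` of C¹ functions on `[0,1]` which is an orthogonal basis of the
weighted space `L²((0,1), w dx)`, vanishes at `1`, and has skew-symmetric differentiation
matrix `D m n = ⟨⟨q m', q n⟩⟩`. -/
theorem stmt_0 (w : ℝ → ℝ)
    (hw : ContDiffOn ℝ 1 w (Icc 0 1))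
    (hw0 : w 0 = 0)
    (hwpos : ∀ x ∈ Ioo (0 : ℝ) 1, 0 < w x)
    (hwint : IntegrableOn (fun x => (deriv w x) ^ 2 / w x) (Ioo (0 : ℝ) 1)) :
    ¬ ∃ q : ℕ → ℝ → ℝ,
      (∀ n, ContDiffOn ℝ 1 (q n) (Icc 0 1)) ∧
      (∀ m n, m ≠ n → (∫ x in (0 : ℝ)..1, w x * q m x * q n x) = 0) ∧
      (∀ n, 0 < ∫ x in (0 : ℝ)..1, w x * q n x * q n x) ∧
      Dense (Submodule.span ℝ
        {f : Lp ℝ 2 ((volume.restrict (Ioo (0 : ℝ) 1)).withDensity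
            (fun x => ENNReal.ofReal (w x))) |
          ∃ n, (f : ℝ → ℝ)
            =ᵐ[(volume.restrict (Ioo (0 : ℝ) 1)).withDensity (fun x => ENNReal.ofReal (w x))]
              q n} :
        Set (Lp ℝ 2 ((volume.restrict (Ioo (0 : ℝ) 1)).withDensity
            (fun x => ENNReal.ofReal (w x))))) ∧
      (∀ n, q n 1 = 0) ∧
      (∀ m n, (∫ x in (0 : ℝ)..1, w x * deriv (q m) x * q n x)
        = - ∫ x in (0 : ℝ)..1, w x * deriv (q n) x * q m x) := by
  rintro ⟨q, hq, -, -, hdense, hq1, hskew⟩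
  have hwm : AEMeasurable w (volume.restrict (Ioo 0 1)) :=
    (hw.continuousOn.mono Ioo_subset_Icc_self).aemeasurable measurableSet_Ioo
  have hqm (m) : AEMeasurable (q m) (volume.restrict (Ioo 0 1)) :=
    ((hq m).continuousOn.mono Ioo_subset_Icc_self).aemeasurable measurableSet_Ioo
  have hderiv (m n) : ∫ x in Ioo (0 : ℝ) 1, deriv w x * q m x * q n x = 0 := by
    have h := setIntegral_deriv_mul_mul one_pos hw (hq m) (hq n)
    have h' := hskew m n
    rw [hw0, hq1 m] at h
    simp only [intervalIntegral.integral_of_le zero_le_one, integral_Ioc_eq_integral_Ioo] at h'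
    linarith
  have hlogm : AEMeasurable (fun x => deriv w x / w x) (volume.restrict (Ioo 0 1)) :=
    (measurable_deriv w).aemeasurable.div hwm
  have hmul (m) : ∀ᵐ x ∂volume.restrict (Ioo (0 : ℝ) 1), deriv w x / w x * q m x = 0 := by
    refine ae_eq_zero_of_weighted_orthogonal measurableSet_Ioo hwm hwpos hdense
      (hlogm.mul (hqm m)) ?_ fun n => ?_
    · obtain ⟨C, hC⟩ := isCompact_Icc.exists_bound_of_continuousOn ((hq m).continuousOn.pow 2)
      refine (hwint.bdd_mul (c := C) ((hqm m).pow_const 2).aestronglyMeasurable ?_).congr ?_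
      · filter_upwards [ae_restrict_mem measurableSet_Ioo] with x hx
          using hC x (Ioo_subset_Icc_self hx)
      · filter_upwards [ae_restrict_mem measurableSet_Ioo] with x hx
        have := (hwpos x hx).ne'
        field_simp
    · refine (setIntegral_congr_fun measurableSet_Ioo fun x hx => ?_).trans (hderiv m n)
      have := (hwpos x hx).ne'
      field_simp
  have hzero : ∀ᵐ x ∂volume.restrict (Ioo (0 : ℝ) 1), deriv w x / w x = 0 := by
    refine ae_eq_zero_of_weighted_orthogonal measurableSet_Ioo hwm hwpos hdense hlogm ?_
      fun n => ?_
    · refine hwint.congr_fun (fun x hx => ?_) measurableSet_Ioo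
      have := (hwpos x hx).ne'
      field_simp
    · refine integral_eq_zero_of_ae ?_
      filter_upwards [hmul n] with x hx
      simp [hx]
  have hw' : ∀ᵐ x ∂volume.restrict (Ioo (0 : ℝ) 1), deriv w x = 0 := by
    filter_upwards [hzero, ae_restrict_mem measurableSet_Ioo] with x h hx
    exact (div_eq_zero_iff.1 h).resolve_right (hwpos x hx).ne'
  have hsub : Ioo (0 : ℝ) (1 / 2) ⊆ Ioo 0 1 := Ioo_subset_Ioo_right one_half_lt_one.le
  have hftc : ∫ x in (0 : ℝ)..(1 / 2), deriv w x = w (1 / 2) - w 0 := by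
    refine intervalIntegral.integral_eq_sub_of_hasDerivAt_of_le (by norm_num)
      (hw.continuousOn.mono (Icc_subset_Icc_right one_half_lt_one.le))
      (fun x hx => hw.hasDerivAt_of_mem_Ioo (hsub hx)) ?_
    rw [intervalIntegrable_iff_integrableOn_Ioo_of_le (by norm_num)]
    simpa using (hw.integrableOn_deriv_mul one_pos (continuousOn_const (c := 1))).mono_set hsub
  rw [intervalIntegral.integral_of_le one_half_pos.le, integral_Ioc_eq_integral_Ioo,
    integral_eq_zero_of_ae (ae_restrict_of_ae_restrict_of_subset hsub hw'), hw0] at hftc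
  linarith [hwpos (1 / 2) (by norm_num)]
end

section
/- Let w : [0,1] → ℝ be continuously differentiable with w(x) > 0 for all x ∈ (0,1) and ∫₀¹ w'(x)²/w(x) dx < ∞, and let (q_n)_{n∈ℕ} be a sequence of continuous real-valued functions on [0,1] such that ⟨⟨q_m, q_n⟩⟩ = 0 for m ≠ n, ⟨⟨q_n, q_n⟩⟩ > 0 for all n, and the linear span of {q_n : n ∈ ℕ} is dense in L²((0,1), w(x)dx). If ∫₀¹ w'(x) q_m(x) q_n(x) dx = 0 for all m, n ∈ ℕ, then w'(x) = 0 for all x ∈ (0,1). -/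
open MeasureTheory Set

/-- A function in `L²(w dx)` which is continuous on `(0,1)` and orthogonal to a sequence with dense
span vanishes on `(0,1)`. -/
theorem eqOn_zero_of_dense_of_integral_eq_zero {w : ℝ → ℝ} (hw : ContinuousOn w (Ioo 0 1))
    (hwpos : ∀ x ∈ Ioo (0 : ℝ) 1, 0 < w x) {q : ℕ → ℝ → ℝ}
    (hdense : Dense (Submodule.span ℝ
      {f : Lp ℝ 2 ((volume.restrict (Ioo (0 : ℝ) 1)).withDensity
          (fun x => ENNReal.ofReal (w x))) |
        ∃ n, (f : ℝ → ℝ)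
          =ᵐ[(volume.restrict (Ioo (0 : ℝ) 1)).withDensity (fun x => ENNReal.ofReal (w x))]
            q n} :
      Set (Lp ℝ 2 ((volume.restrict (Ioo (0 : ℝ) 1)).withDensity
          (fun x => ENNReal.ofReal (w x))))))
    {h : ℝ → ℝ} (hh : ContinuousOn h (Ioo 0 1))
    (hint : IntegrableOn (fun x => w x * h x ^ 2) (Ioo (0 : ℝ) 1))
    (hzero : ∀ n, ∫ x in Ioo (0 : ℝ) 1, w x * (h x * q n x) = 0) :
    ∀ x ∈ Ioo (0 : ℝ) 1, h x = 0 := by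
  set ν := volume.restrict (Ioo (0 : ℝ) 1) with hν
  set μ := ν.withDensity (fun x => ENNReal.ofReal (w x)) with hμ
  have hwm : AEMeasurable (fun x => ENNReal.ofReal (w x)) ν :=
    (hw.aemeasurable measurableSet_Ioo).ennreal_ofReal
  have hfin : ∀ᵐ x ∂ν, ENNReal.ofReal (w x) < ⊤ := .of_forall fun x => ENNReal.ofReal_lt_top
  have hmem : ∀ᵐ x ∂ν, x ∈ Ioo (0 : ℝ) 1 := ae_restrict_mem measurableSet_Ioo
  have hhm : AEStronglyMeasurable h μ :=
    (hh.aestronglyMeasurable measurableSet_Ioo).mono_ac (withDensity_absolutelyContinuous _ _)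
  have hL : MemLp h 2 μ := by
    rw [memLp_two_iff_integrable_sq hhm, hμ, integrable_withDensity_iff_integrable_smul₀' hwm hfin]
    refine hint.congr ?_
    filter_upwards [hmem] with x hx
    simp [ENNReal.toReal_ofReal (hwpos x hx).le]
  have hz : hL.toLp h = 0 := by
    refine hdense.eq_zero_of_inner_left (𝕜 := ℝ) fun v hv => ?_
    induction hv using Submodule.span_induction with
    | zero => simp
    | add x y _ _ hx hy => rw [inner_add_right, hx, hy, add_zero]
    | smul a x _ hx => rw [inner_smul_right, hx, mul_zero]
    | mem v hv =>
      obtain ⟨n, hn⟩ := hv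
      rw [L2.inner_def]
      have h1 : ∫ x, inner ℝ (hL.toLp h x) (v x) ∂μ = ∫ x, h x * q n x ∂μ := by
        refine integral_congr_ae ?_
        filter_upwards [hL.coeFn_toLp, hn] with x hx hx'
        rw [hx, hx']
        simp [mul_comm]
      rw [h1, hμ, integral_withDensity_eq_integral_toReal_smul₀ hwm hfin, ← hzero n]
      refine integral_congr_ae ?_
      filter_upwards [hmem] with x hx
      simp [ENNReal.toReal_ofReal (hwpos x hx).le]
  have hae : h =ᵐ[μ] 0 := (MemLp.toLp_eq_toLp_iff hL MemLp.zero).1 hz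
  have hae' : h =ᵐ[ν] 0 := by
    filter_upwards [(ae_withDensity_iff' hwm).1 hae, hmem] with x hx hx'
    exact hx (by simpa using hwpos x hx')
  exact Measure.eqOn_open_of_ae_eq hae' isOpen_Ioo hh continuousOn_const

open MeasureTheory Set

/-- If `(q n)` is an orthogonal basis of the weighted space `L²((0,1), w dx)` and
`∫₀¹ w' (q m) (q n) = 0` for all `m, n`, then `w' = 0` on `(0,1)`. -/
theorem stmt_2 (w : ℝ → ℝ)
    (hw : ContDiffOn ℝ 1 w (Icc 0 1))
    (hwpos : ∀ x ∈ Ioo (0 : ℝ) 1, 0 < w x)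
    (hwint : IntegrableOn (fun x => (deriv w x) ^ 2 / w x) (Ioo (0 : ℝ) 1))
    (q : ℕ → ℝ → ℝ)
    (hq : ∀ n, ContinuousOn (q n) (Icc 0 1))
    (horth : ∀ m n, m ≠ n → (∫ x in (0 : ℝ)..1, w x * q m x * q n x) = 0)
    (hpos : ∀ n, 0 < ∫ x in (0 : ℝ)..1, w x * q n x * q n x)
    (hdense : Dense (Submodule.span ℝ
      {f : Lp ℝ 2 ((volume.restrict (Ioo (0 : ℝ) 1)).withDensity
          (fun x => ENNReal.ofReal (w x))) |
        ∃ n, (f : ℝ → ℝ)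
          =ᵐ[(volume.restrict (Ioo (0 : ℝ) 1)).withDensity (fun x => ENNReal.ofReal (w x))]
            q n} :
      Set (Lp ℝ 2 ((volume.restrict (Ioo (0 : ℝ) 1)).withDensity
          (fun x => ENNReal.ofReal (w x))))))
    (hzero : ∀ m n, (∫ x in (0 : ℝ)..1, deriv w x * q m x * q n x) = 0) :
    ∀ x ∈ Ioo (0 : ℝ) 1, deriv w x = 0 := by
  have hwc : ContinuousOn w (Ioo 0 1) := hw.continuousOn.mono Ioo_subset_Icc_self
  have hdc : ContinuousOn (deriv w) (Ioo 0 1) :=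
    (hw.mono Ioo_subset_Icc_self).continuousOn_deriv_of_isOpen isOpen_Ioo le_rfl
  have hgc : ContinuousOn (fun x => deriv w x / w x) (Ioo 0 1) :=
    hdc.div hwc fun x hx => (hwpos x hx).ne'
  have hqc : ∀ n, ContinuousOn (q n) (Ioo 0 1) := fun n => (hq n).mono Ioo_subset_Icc_self
  have hprod : ∀ m, ∀ x ∈ Ioo (0 : ℝ) 1, deriv w x / w x * q m x = 0 := by
    intro m
    refine eqOn_zero_of_dense_of_integral_eq_zero hwc hwpos hdense (hgc.mul (hqc m)) ?_ fun n => ?_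
    · obtain ⟨C, hC⟩ := isCompact_Icc.exists_bound_of_continuousOn (hq m)
      refine (Integrable.bdd_mul (c := C ^ 2) hwint
        (((hqc m).pow 2).aestronglyMeasurable measurableSet_Ioo) ?_).congr ?_
      · filter_upwards [ae_restrict_mem measurableSet_Ioo] with x hx
        rw [Pi.pow_apply, norm_pow]
        exact pow_le_pow_left₀ (norm_nonneg _) (hC x (Ioo_subset_Icc_self hx)) 2
      · filter_upwards [ae_restrict_mem measurableSet_Ioo] with x hx
        have := (hwpos x hx).ne'
        simp only [Pi.pow_apply]
        field_simp
    · refine Eq.trans ?_ (hzero m n)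
      rw [intervalIntegral.integral_of_le zero_le_one, integral_Ioc_eq_integral_Ioo]
      refine setIntegral_congr_fun measurableSet_Ioo fun x hx => ?_
      have := (hwpos x hx).ne'
      field_simp
  have hquot : ∀ x ∈ Ioo (0 : ℝ) 1, deriv w x / w x = 0 := by
    refine eqOn_zero_of_dense_of_integral_eq_zero hwc hwpos hdense hgc ?_ fun n => ?_
    · refine hwint.congr_fun (fun x hx => ?_) measurableSet_Ioo
      have := (hwpos x hx).ne'
      field_simp
    · refine setIntegral_eq_zero_of_forall_eq_zero fun x hx => ?_
      rw [hprod n x hx, mul_zero]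
  intro x hx
  exact (div_eq_zero_iff.1 (hquot x hx)).resolve_right (hwpos x hx).ne'
end

section
/- Let a < b be real numbers, let w : (a,b) → ℝ be a measurable integrable weight with w(x) > 0 for almost every x ∈ (a,b), and let (p_n)_{n∈ℕ} be a sequence of real polynomials with deg p_n = n that is orthonormal with respect to w, i.e. ∫ₐᵇ w(x) p_m(x) p_n(x) dx = δ_{m,n}. Then the W-functions φ_n(x) = √(w(x)) · p_n(x), n ∈ ℕ, form an orthonormal basis of L²(a,b): they are orthonormal in L²(a,b) and their linear span is dense in L²(a,b). -/
open MeasureTheory Set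

/-- A family of real polynomials with one member of each degree spans all polynomials. -/
lemma span_range_eq_top_of_degree_eq {p : ℕ → Polynomial ℝ}
    (hdeg : ∀ n, (p n).degree = (n : WithBot ℕ)) :
    Submodule.span ℝ (range p) = ⊤ := by
  let S : Polynomial.Sequence ℝ := ⟨p, hdeg⟩
  exact S.span fun i => (Polynomial.leadingCoeff_ne_zero.2 (S.ne_zero i)).isUnit

/-- A continuous function multiplied by an integrable function on a bounded interval is
integrable. -/
lemma integrable_mul_of_continuous {a b : ℝ} {F g : ℝ → ℝ}
    (hF : IntegrableOn F (Ioo a b)) (hg : Continuous g) :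
    IntegrableOn (fun x => F x * g x) (Ioo a b) := by
  obtain ⟨C, hC⟩ := (isCompact_Icc (a := a) (b := b)).exists_bound_of_continuousOn hg.continuousOn
  refine Integrable.mul_bdd (c := C) hF hg.aestronglyMeasurable ?_
  filter_upwards [ae_restrict_mem measurableSet_Ioo] with x hx
  exact hC x (Ioo_subset_Icc_self hx)

/-- An integrable function on a bounded interval whose moments all vanish is zero a.e. -/
lemma ae_eq_zero_of_integral_mul_polynomial_eq_zero {a b : ℝ} {F : ℝ → ℝ}
    (hF : IntegrableOn F (Ioo a b))
    (h : ∀ q : Polynomial ℝ, ∫ x in Ioo a b, F x * q.eval x = 0) :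
    ∀ᵐ x ∂(volume.restrict (Ioo a b)), F x = 0 := by
  have key : ∀ g : ℝ → ℝ, Continuous g → ∫ x in Ioo a b, F x * g x = 0 := by
    intro g hg
    set M := ∫ x in Ioo a b, |F x|
    have hM : 0 ≤ M := integral_nonneg fun x => abs_nonneg _
    have bound : ∀ ε > 0, |∫ x in Ioo a b, F x * g x| ≤ ε * M := by
      intro ε hε
      obtain ⟨q, hq⟩ := exists_polynomial_near_of_continuousOn a b g hg.continuousOn ε hε
      calc |∫ x in Ioo a b, F x * g x|
          = |∫ x in Ioo a b, F x * (g x - q.eval x)| := by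
            simp only [mul_sub]
            rw [integral_sub (integrable_mul_of_continuous hF hg)
              (integrable_mul_of_continuous hF q.continuous), h q, sub_zero]
        _ ≤ ∫ x in Ioo a b, ε * |F x| := by
            rw [← Real.norm_eq_abs]
            refine norm_integral_le_of_norm_le (hF.norm.const_mul ε) ?_
            filter_upwards [ae_restrict_mem measurableSet_Ioo] with x hx
            rw [Real.norm_eq_abs, abs_mul, mul_comm, abs_sub_comm]
            exact mul_le_mul_of_nonneg_right (hq x (Ioo_subset_Icc_self hx)).le (abs_nonneg _)
        _ = ε * M := integral_const_mul _ _
    rw [← abs_nonpos_iff]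
    refine le_of_forall_pos_le_add fun δ hδ => ?_
    have := bound (δ / (M + 1)) (by positivity)
    rw [zero_add]
    refine this.trans ?_
    rw [div_mul_eq_mul_div, div_le_iff₀ (by positivity)]
    nlinarith
  refine ae_eq_zero_of_integral_contDiff_smul_eq_zero hF.locallyIntegrable fun g hg _ => ?_
  simpa only [smul_eq_mul, mul_comm] using key g hg.continuous

/-- The W-functions `φ n = √w · p n` built from polynomials orthonormal with respect to an
integrable weight `w > 0` a.e. on a bounded interval `(a,b)` form an orthonormal basis of
the (unweighted) `L²(a,b)`: they are orthonormal and their span is dense. -/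
theorem stmt_5 (a b : ℝ) (hab : a < b) (w : ℝ → ℝ)
    (hw_meas : Measurable w)
    (hw_int : IntegrableOn w (Ioo a b))
    (hw_pos : ∀ᵐ x ∂(volume.restrict (Ioo a b)), 0 < w x)
    (p : ℕ → Polynomial ℝ)
    (hdeg : ∀ n, (p n).degree = (n : WithBot ℕ))
    (horth : ∀ m n, (∫ x in a..b, w x * (p m).eval x * (p n).eval x)
      = if m = n then 1 else 0) :
    (∀ m n, (∫ x in a..b,
        (Real.sqrt (w x) * (p m).eval x) * (Real.sqrt (w x) * (p n).eval x))
      = if m = n then 1 else 0) ∧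
    Dense (Submodule.span ℝ
      {g : Lp ℝ 2 (volume.restrict (Ioo a b)) |
        ∃ n, (g : ℝ → ℝ) =ᵐ[volume.restrict (Ioo a b)]
          fun x => Real.sqrt (w x) * (p n).eval x} :
      Set (Lp ℝ 2 (volume.restrict (Ioo a b)))) := by
  refine ⟨fun m n => ?_, ?_⟩
  · rw [← horth m n, intervalIntegral.integral_of_le hab.le, intervalIntegral.integral_of_le hab.le,
      integral_Ioc_eq_integral_Ioo, integral_Ioc_eq_integral_Ioo]
    refine integral_congr_ae ?_
    filter_upwards [hw_pos] with x hx
    linear_combination (p m).eval x * (p n).eval x * Real.mul_self_sqrt hx.le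
  have hsqrt : MemLp (fun x => Real.sqrt (w x)) 2 (volume.restrict (Ioo a b)) := by
    rw [memLp_two_iff_integrable_sq hw_meas.sqrt.aestronglyMeasurable]
    refine hw_int.congr ?_
    filter_upwards [hw_pos] with x hx
    rw [Real.sq_sqrt hx.le]
  have hφ : ∀ n, MemLp (fun x => Real.sqrt (w x) * (p n).eval x) 2
      (volume.restrict (Ioo a b)) := by
    intro n
    have hmeas : Measurable fun x => Real.sqrt (w x) * (p n).eval x :=
      hw_meas.sqrt.mul (p n).continuous.measurable
    rw [memLp_two_iff_integrable_sq hmeas.aestronglyMeasurable]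
    simp only [mul_pow]
    exact integrable_mul_of_continuous hsqrt.integrable_sq ((p n).continuous.pow 2)
  rw [Submodule.dense_iff_topologicalClosure_eq_top, Submodule.topologicalClosure_eq_top_iff,
    Submodule.eq_bot_iff]
  intro f hf
  have hF : IntegrableOn (fun x => f x * Real.sqrt (w x)) (Ioo a b) :=
    (Lp.memLp f).integrable_mul hsqrt
  have hp : ∀ n, ∫ x in Ioo a b, f x * Real.sqrt (w x) * (p n).eval x = 0 := by
    intro n
    have h := hf _ (Submodule.subset_span ⟨n, (hφ n).coeFn_toLp⟩)
    rw [L2.inner_def] at h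
    rw [← h]
    refine integral_congr_ae ?_
    filter_upwards [(hφ n).coeFn_toLp] with x hx
    simp only [hx, RCLike.inner_apply, conj_trivial]
    ring
  have hq : ∀ q : Polynomial ℝ, ∫ x in Ioo a b, f x * Real.sqrt (w x) * q.eval x = 0 := by
    intro q
    have hmem : q ∈ Submodule.span ℝ (range p) := by
      rw [span_range_eq_top_of_degree_eq hdeg]; trivial
    induction hmem using Submodule.span_induction with
    | mem x hx => obtain ⟨n, rfl⟩ := hx; exact hp n
    | zero => simp
    | add x y _ _ hx hy =>
      simp only [Polynomial.eval_add, mul_add]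
      rw [integral_add (integrable_mul_of_continuous hF x.continuous)
        (integrable_mul_of_continuous hF y.continuous), hx, hy, add_zero]
    | smul c x _ hx =>
      simp only [Polynomial.eval_smul, smul_eq_mul, mul_left_comm _ c]
      rw [integral_const_mul, hx, mul_zero]
  rw [Lp.eq_zero_iff_ae_eq_zero]
  filter_upwards [ae_eq_zero_of_integral_mul_polynomial_eq_zero hF hq, hw_pos] with x hx hwx
  exact (mul_eq_zero.1 hx).resolve_right (Real.sqrt_pos.2 hwx).ne'
end
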